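/- In the hyperbolic linear cocycle setting with bounded inhomogeneity (X_k), define for k ≥ 0: v'_k := Σ_{n=0}^{k−1} Φ_{k−n}^{(n)} X_{k−n} (so v'_0 = 0) and v^P_k := Σ_{n=0}^{k−1} Φ_{k−n}^{(n)} P⁻_{k−n} X_{k−n} − Σ_{n≥1} Φ_{k+n}^{(−n)} P⁺_{k+n} X_{k+n} (the infinite series converging absolutely). Then: (i) v'_{k+1} = A_k v'_k + X_{k+1} for all k ≥ 0; (ii) v^P_{k+1} = A_k v^P_k + X_{k+1} for all k ≥ 0; (iii) v^P_k − v'_k ∈ range(P⁺_k) for every k ≥ 0; and (iv) the difference of any two inhomogeneous tangent solutions is a homogeneous tangent solution. -/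

import Mathlib

/-- The cocycle `Φ_k^{(n)} := A_{k+n−1} ∘ ⋯ ∘ A_k`, with `Φ_k^{(0)} = id`;
`Φ_k^{(−n)}` is realized as `(Phi A (k−n) n).symm`. -/
noncomputable def Phi {M : ℕ}
    (A : ℤ → EuclideanSpace ℝ (Fin M) ≃L[ℝ] EuclideanSpace ℝ (Fin M)) :
    ℤ → ℕ → (EuclideanSpace ℝ (Fin M) ≃L[ℝ] EuclideanSpace ℝ (Fin M))
  | _, 0 => ContinuousLinearEquiv.refl ℝ _
  | k, (n + 1) => (Phi A k n).trans (A (k + n))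

/-- `v'_k := Σ_{n=0}^{k−1} Φ_{k−n}^{(n)} X_{k−n}`, the inhomogeneous tangent solution
with zero initial condition. -/
noncomputable def vprime {M : ℕ}
    (A : ℤ → EuclideanSpace ℝ (Fin M) ≃L[ℝ] EuclideanSpace ℝ (Fin M))
    (X : ℤ → EuclideanSpace ℝ (Fin M)) (k : ℕ) : EuclideanSpace ℝ (Fin M) :=
  ∑ n ∈ Finset.range k, Phi A ((k : ℤ) - n) n (X ((k : ℤ) - n))

/-- The pivot solution
`v^P_k := Σ_{n=0}^{k−1} Φ_{k−n}^{(n)} P⁻_{k−n} X_{k−n} − Σ_{n≥1} Φ_{k+n}^{(−n)} P⁺_{k+n} X_{k+n}`. -/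
noncomputable def vpivot {M : ℕ}
    (A : ℤ → EuclideanSpace ℝ (Fin M) ≃L[ℝ] EuclideanSpace ℝ (Fin M))
    (Pp Pm : ℤ → EuclideanSpace ℝ (Fin M) →L[ℝ] EuclideanSpace ℝ (Fin M))
    (X : ℤ → EuclideanSpace ℝ (Fin M)) (k : ℕ) : EuclideanSpace ℝ (Fin M) :=
  (∑ n ∈ Finset.range k, Phi A ((k : ℤ) - n) n (Pm ((k : ℤ) - n) (X ((k : ℤ) - n))))
    - ∑' n : ℕ, (Phi A (k : ℤ) (n + 1)).symm (Pp ((k : ℤ) + n + 1) (X ((k : ℤ) + n + 1)))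

section Cocycle

variable {M : ℕ} (A : ℤ → EuclideanSpace ℝ (Fin M) ≃L[ℝ] EuclideanSpace ℝ (Fin M))

theorem Phi_zero_apply (k : ℤ) (x : EuclideanSpace ℝ (Fin M)) : Phi A k 0 x = x := rfl

theorem Phi_succ_apply (k : ℤ) (n : ℕ) (x : EuclideanSpace ℝ (Fin M)) :
    Phi A k (n + 1) x = A (k + n) (Phi A k n x) := rfl

theorem Phi_succ_apply' (k : ℤ) (n : ℕ) (x : EuclideanSpace ℝ (Fin M)) :
    Phi A k (n + 1) x = Phi A (k + 1) n (A k x) := by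
  induction n with
  | zero => simp [Phi_succ_apply, Phi_zero_apply]
  | succ n ih =>
    rw [Phi_succ_apply, ih, Phi_succ_apply, show k + ((n + 1 : ℕ) : ℤ) = k + 1 + n by push_cast; ring]

theorem apply_Phi_succ_symm (k : ℤ) (n : ℕ) (y : EuclideanSpace ℝ (Fin M)) :
    A k ((Phi A k (n + 1)).symm y) = (Phi A (k + 1) n).symm y := by
  rw [ContinuousLinearEquiv.eq_symm_apply, ← Phi_succ_apply',
    ContinuousLinearEquiv.apply_symm_apply]

theorem vprime_succ (X : ℤ → EuclideanSpace ℝ (Fin M)) (k : ℕ) :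
    vprime A X (k + 1) = A (k : ℤ) (vprime A X k) + X ((k : ℤ) + 1) := by
  unfold vprime
  rw [Finset.sum_range_succ', map_sum]
  refine congrArg₂ (· + ·) (Finset.sum_congr rfl fun n _ => ?_) (by simp [Phi_zero_apply])
  rw [show ((k + 1 : ℕ) : ℤ) - ((n + 1 : ℕ) : ℤ) = k - n by push_cast; ring,
    Phi_succ_apply, sub_add_cancel]

variable {A} {Pp : ℤ → EuclideanSpace ℝ (Fin M) →L[ℝ] EuclideanSpace ℝ (Fin M)}

theorem Phi_apply_proj (hequiv : ∀ k x, A k (Pp k x) = Pp (k + 1) (A k x))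
    (k : ℤ) (n : ℕ) (x : EuclideanSpace ℝ (Fin M)) :
    Phi A k n (Pp k x) = Pp (k + n) (Phi A k n x) := by
  induction n with
  | zero => simp [Phi_zero_apply]
  | succ n ih => rw [Phi_succ_apply, ih, hequiv, Phi_succ_apply, Nat.cast_succ, add_assoc]

theorem proj_Phi_symm (hequiv : ∀ k x, A k (Pp k x) = Pp (k + 1) (A k x))
    (k : ℤ) (n : ℕ) (y : EuclideanSpace ℝ (Fin M)) :
    Pp k ((Phi A k n).symm y) = (Phi A k n).symm (Pp (k + n) y) := by
  rw [ContinuousLinearEquiv.eq_symm_apply, Phi_apply_proj hequiv,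
    ContinuousLinearEquiv.apply_symm_apply]

theorem summable_norm_Phi_symm_proj {C₁ lam χ : ℝ} (hC₁ : 0 ≤ C₁) (hlam0 : 0 ≤ lam)
    (hlam1 : lam < 1)
    (hunstab : ∀ (k : ℤ) (n : ℕ) (x), ‖(Phi A (k - n) n).symm (Pp k x)‖ ≤ C₁ * lam ^ n * ‖x‖)
    {X : ℤ → EuclideanSpace ℝ (Fin M)} (hχ : ∀ k, ‖X k‖ ≤ χ) (k : ℤ) :
    Summable fun n : ℕ => ‖(Phi A k (n + 1)).symm (Pp (k + n + 1) (X (k + n + 1)))‖ := by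
  have hg : Summable fun n : ℕ => C₁ * lam ^ (n + 1) * χ :=
    (((summable_nat_add_iff 1).2 (summable_geometric_of_lt_one hlam0 hlam1)).mul_left C₁).mul_right χ
  refine hg.of_nonneg_of_le (fun _ => norm_nonneg _) fun n => ?_
  have h := hunstab (k + n + 1) (n + 1) (X (k + n + 1))
  rw [show k + n + 1 - ((n + 1 : ℕ) : ℤ) = k by push_cast; ring] at h
  exact h.trans (mul_le_mul_of_nonneg_left (hχ _) (by positivity))

theorem apply_tsum_Phi_symm {Y : ℤ → EuclideanSpace ℝ (Fin M)} {k : ℤ}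
    (hY : Summable fun n : ℕ => (Phi A k (n + 1)).symm (Y (k + n + 1))) :
    A k (∑' n : ℕ, (Phi A k (n + 1)).symm (Y (k + n + 1))) =
      Y (k + 1) + ∑' n : ℕ, (Phi A (k + 1) (n + 1)).symm (Y (k + 1 + n + 1)) := by
  have hA : Summable fun n : ℕ => A k ((Phi A k (n + 1)).symm (Y (k + n + 1))) :=
    (A k).summable.2 hY
  rw [(A k).map_tsum, hA.tsum_eq_zero_add]
  simp only [apply_Phi_succ_symm]
  congr 1
  · simp [Phi]
  · refine tsum_congr fun n => ?_
    rw [show k + ((n + 1 : ℕ) : ℤ) + 1 = k + 1 + n + 1 by push_cast; ring]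

theorem proj_tsum_Phi_symm (hequiv : ∀ k x, A k (Pp k x) = Pp (k + 1) (A k x))
    (hPp : ∀ k x, Pp k (Pp k x) = Pp k x) {X : ℤ → EuclideanSpace ℝ (Fin M)} {k : ℤ}
    (hX : Summable fun n : ℕ => (Phi A k (n + 1)).symm (Pp (k + n + 1) (X (k + n + 1)))) :
    Pp k (∑' n : ℕ, (Phi A k (n + 1)).symm (Pp (k + n + 1) (X (k + n + 1)))) =
      ∑' n : ℕ, (Phi A k (n + 1)).symm (Pp (k + n + 1) (X (k + n + 1))) := by
  rw [(Pp k).map_tsum hX]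
  refine tsum_congr fun n => ?_
  rw [proj_Phi_symm hequiv, Nat.cast_succ, ← add_assoc, hPp]

theorem proj_vprime (hequiv : ∀ k x, A k (Pp k x) = Pp (k + 1) (A k x))
    (X : ℤ → EuclideanSpace ℝ (Fin M)) (k : ℕ) :
    Pp k (vprime A X k) = vprime A (fun j => Pp j (X j)) k := by
  unfold vprime
  rw [map_sum]
  refine Finset.sum_congr rfl fun n _ => ?_
  rw [Phi_apply_proj hequiv, sub_add_cancel]

theorem vprime_add (X Y : ℤ → EuclideanSpace ℝ (Fin M)) (k : ℕ) :
    vprime A (fun j => X j + Y j) k = vprime A X k + vprime A Y k := by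
  simp [vprime, Finset.sum_add_distrib]

theorem vpivot_eq (Pm : ℤ → EuclideanSpace ℝ (Fin M) →L[ℝ] EuclideanSpace ℝ (Fin M))
    (X : ℤ → EuclideanSpace ℝ (Fin M)) (k : ℕ) :
    vpivot A Pp Pm X k = vprime A (fun j => Pm j (X j)) k
      - ∑' n : ℕ, (Phi A (k : ℤ) (n + 1)).symm
          (Pp ((k : ℤ) + n + 1) (X ((k : ℤ) + n + 1))) := rfl

end Cocycle

/-- `v'` and `v^P` are inhomogeneous tangent solutions (the infinite
series in `v^P` converging absolutely), `v'_0 = 0`, `v^P_k − v'_k ∈ range P⁺_k`, and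
the difference of any two inhomogeneous tangent solutions is a homogeneous tangent
solution. -/
theorem stmt2 (M : ℕ) (hM : 0 < M)
    (A : ℤ → EuclideanSpace ℝ (Fin M) ≃L[ℝ] EuclideanSpace ℝ (Fin M))
    (Pp Pm : ℤ → EuclideanSpace ℝ (Fin M) →L[ℝ] EuclideanSpace ℝ (Fin M))
    (hPp : ∀ k x, Pp k (Pp k x) = Pp k x)
    (hPm : ∀ k x, Pm k (Pm k x) = Pm k x)
    (hsum : ∀ k x, Pp k x + Pm k x = x)
    (hequiv : ∀ k x, A k (Pp k x) = Pp (k + 1) (A k x))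
    (C₁ lam : ℝ) (hC₁ : 1 ≤ C₁) (hlam0 : 0 < lam) (hlam1 : lam < 1)
    (hstab : ∀ (k : ℤ) (n : ℕ) (x), ‖Phi A k n (Pm k x)‖ ≤ C₁ * lam ^ n * ‖x‖)
    (hunstab : ∀ (k : ℤ) (n : ℕ) (x), ‖(Phi A (k - n) n).symm (Pp k x)‖ ≤ C₁ * lam ^ n * ‖x‖)
    (X : ℤ → EuclideanSpace ℝ (Fin M)) (χ : ℝ) (hχ : ∀ k, ‖X k‖ ≤ χ) :
    (∀ k : ℕ, Summable
        (fun n : ℕ => ‖(Phi A (k : ℤ) (n + 1)).symm (Pp ((k : ℤ) + n + 1) (X ((k : ℤ) + n + 1)))‖))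
    ∧ vprime A X 0 = 0
    ∧ (∀ k : ℕ, vprime A X (k + 1) = A (k : ℤ) (vprime A X k) + X ((k : ℤ) + 1))
    ∧ (∀ k : ℕ, vpivot A Pp Pm X (k + 1) = A (k : ℤ) (vpivot A Pp Pm X k) + X ((k : ℤ) + 1))
    ∧ (∀ k : ℕ, vpivot A Pp Pm X k - vprime A X k ∈ Set.range (Pp (k : ℤ)))
    ∧ (∀ w₁ w₂ : ℤ → EuclideanSpace ℝ (Fin M),
        (∀ k : ℤ, w₁ (k + 1) = A k (w₁ k) + X (k + 1)) →
        (∀ k : ℤ, w₂ (k + 1) = A k (w₂ k) + X (k + 1)) →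
        ∀ k : ℤ, w₁ (k + 1) - w₂ (k + 1) = A k (w₁ k - w₂ k)) := by
  have hS := summable_norm_Phi_symm_proj (zero_le_one.trans hC₁) hlam0.le hlam1 hunstab hχ
  refine ⟨fun k => hS k, by simp [vprime], vprime_succ A X, fun k => ?_, fun k => ?_,
    fun w₁ w₂ h₁ h₂ k => ?_⟩
  · have hT := apply_tsum_Phi_symm (Y := fun j => Pp j (X j)) (hS k).of_norm
    rw [vpivot_eq, vpivot_eq, vprime_succ, map_sub, hT, Nat.cast_succ,
      eq_sub_of_add_eq' (hsum (k + 1) (X (k + 1)))]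
    abel
  · have hsplit : vprime A X k
        = vprime A (fun j => Pp j (X j)) k + vprime A (fun j => Pm j (X j)) k := by
      rw [← vprime_add]
      simp only [hsum]
    refine ⟨-vprime A X k - ∑' n : ℕ, (Phi A (k : ℤ) (n + 1)).symm
      (Pp ((k : ℤ) + n + 1) (X ((k : ℤ) + n + 1))), ?_⟩
    rw [map_sub, map_neg, proj_vprime hequiv, proj_tsum_Phi_symm hequiv hPp (hS k).of_norm,
      vpivot_eq, hsplit]
    abel
  · rw [h₁, h₂, map_sub]
    abel
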